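/- arXiv:1411.3012 — 2 statements merged into one kernel-verified Lean document; each statement's English description precedes it below -/
import Mathlib

section
/- Let Λ ⊆ Ṫ*U be a cone of the form Λ = Γ ∩ λ, where Γ is a cone closed in Ṫ*U and λ is a cone open in Ṫ*U. Then there exists a sequence (Λ_n)_{n∈ℕ} of cones, each closed in Ṫ*U and with first projection p₁(Λ_n) a compact subset of U, such that: Λ_n ⊆ Λ_{n+1} for all n; each Λ_n is contained in the interior of Λ_{n+1} relative to the subspace Γ; ⋃_n Λ_n = Λ; and every cone Γ' ⊆ Λ that is closed in Ṫ*U and has compact first projection p₁(Γ') ⊆ U is contained in some Λ_n. -/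
open Set Metric

section Defs

variable {X : Type*} [MetricSpace X]

/-- `V` is open in the subspace topology of `U`. -/
def IsOpenIn (U V : Set X) : Prop := ∃ W, IsOpen W ∧ V = W ∩ U

/-- `C` is closed in the subspace topology of `U`. -/
def IsClosedIn (U C : Set X) : Prop := ∃ F, IsClosed F ∧ C = F ∩ U

/-- Closure of `C` in the subspace topology of `U` (for `C ⊆ U`). -/
def closureIn (U C : Set X) : Set X := closure C ∩ U

/-- Interior of `S` in the subspace topology of `U`. -/
def interiorIn (U S : Set X) : Set X := U \ closure (U \ S)

/-- Polar of a family `𝓞` of open subsets of `U`:  closed subsets of `U` whose intersection with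
every member of `𝓞` has compact closure in `U`. -/
def polarO (U : Set X) (𝓞 : Set (Set X)) : Set (Set X) :=
  {C | IsClosedIn U C ∧ ∀ W ∈ 𝓞, IsCompact (closureIn U (C ∩ W))}

/-- Polar of a family `𝓒` of closed subsets of `U`: open subsets of `U` whose intersection with
every member of `𝓒` has compact closure in `U`. -/
def polarC (U : Set X) (𝓒 : Set (Set X)) : Set (Set X) :=
  {V | IsOpenIn U V ∧ ∀ C ∈ 𝓒, IsCompact (closureIn U (V ∩ C))}

/-- `𝓞_𝓒`: the family of relative interiors of members of `𝓒`. -/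
def oFam (U : Set X) (𝓒 : Set (Set X)) : Set (Set X) := interiorIn U '' 𝓒

/-- `𝓒_𝓞`: the family of relative closures of members of `𝓞`. -/
def cFam (U : Set X) (𝓞 : Set (Set X)) : Set (Set X) := closureIn U '' 𝓞

/-- Uniform `ε`-enlargement of `C ⊆ U`:
`C_{uε} = {x ∈ U : ∃ y ∈ C, d(x,y) ≤ min(ε, d(y,M∖U)·(1−e^{−ε})/2)}`, where the distance to the
(possibly empty) complement of `U` is taken in `[0,∞]`. -/
def uEnl (U C : Set X) (ε : ℝ) : Set X :=
  {x | x ∈ U ∧ ∃ y ∈ C, dist x y ≤ ε ∧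
    ENNReal.ofReal (dist x y) ≤ EMetric.infEdist y Uᶜ * ENNReal.ofReal ((1 - Real.exp (-ε)) / 2)}

/-- A family of closed subsets of `U` is uniformly enlargeable if each member has some uniform
`ε`-enlargement in the family. -/
def UniformlyEnlargeable (U : Set X) (𝓒 : Set (Set X)) : Prop :=
  ∀ C ∈ 𝓒, ∃ ε : ℝ, 0 < ε ∧ uEnl U C ε ∈ 𝓒

/-- The cover-dependent `ε`-enlargement `C_ε = ⋃ᵢ cl(Uᵢ) ∩ (cl(Uᵢ) ∩ C)_{uεᵢ}`. -/
def coverEnl {I : Type*} (Ui : I → Set X) (U C : Set X) (ε : I → ℝ) : Set X :=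
  ⋃ i, closure (Ui i) ∩ uEnl U (closure (Ui i) ∩ C) (ε i)

/-- The cover-dependent enlargement `C_{wε} = ⋃ᵢ (cl(Uᵢ) ∩ C)_{uεᵢ}`. -/
def coverWEnl {I : Type*} (Ui : I → Set X) (U C : Set X) (ε : I → ℝ) : Set X :=
  ⋃ i, uEnl U (closure (Ui i) ∩ C) (ε i)

/-- A family of closed subsets of `U` is enlargeable with respect to the cover `Ui` if each
member has some cover-enlargement in the family. -/
def Enlargeable {I : Type*} (Ui : I → Set X) (U : Set X) (𝓒 : Set (Set X)) : Prop :=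
  ∀ C ∈ 𝓒, ∃ ε : I → ℝ, (∀ i, 0 < ε i) ∧ coverEnl Ui U C ε ∈ 𝓒

/-- A cover of `U` by open sets with compact closures contained in `U`, locally finite in `U`. -/
structure GoodCover {I : Type*} (Ui : I → Set X) (U : Set X) : Prop where
  isOpen : ∀ i, IsOpen (Ui i)
  covers : U ⊆ ⋃ i, Ui i
  compactCl : ∀ i, IsCompact (closure (Ui i))
  clSubset : ∀ i, closure (Ui i) ⊆ U
  locFin : ∀ x ∈ U, ∃ t ∈ nhds x, {i | (closure (Ui i) ∩ t).Nonempty}.Finite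

/-- `δ(t) = ln((1+e^{−t})/(3e^{−t}−1))`. -/
noncomputable def deltaFn (t : ℝ) : ℝ :=
  Real.log ((1 + Real.exp (-t)) / (3 * Real.exp (-t) - 1))

end Defs

/-- exhaustion of the intersection of a closed cone and an open cone in
`Ṫ*U = U × (ℝ^d ∖ {0})` by closed cones with compact first projections. -/
theorem stmt18 (d : ℕ) (hd : 1 ≤ d)
    (U : Set (EuclideanSpace ℝ (Fin d))) (hU : IsOpen U)
    (Γ lam : Set (EuclideanSpace ℝ (Fin d) × EuclideanSpace ℝ (Fin d)))
    (hΓcone : ∀ p ∈ Γ, ∀ t : ℝ, 0 < t → (p.1, t • p.2) ∈ Γ)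
    (hlamcone : ∀ p ∈ lam, ∀ t : ℝ, 0 < t → (p.1, t • p.2) ∈ lam)
    (hΓcl : IsClosedIn (U ×ˢ ({0}ᶜ : Set (EuclideanSpace ℝ (Fin d)))) Γ)
    (hlamop : IsOpenIn (U ×ˢ ({0}ᶜ : Set (EuclideanSpace ℝ (Fin d)))) lam) :
    ∃ Λn : ℕ → Set (EuclideanSpace ℝ (Fin d) × EuclideanSpace ℝ (Fin d)),
      (∀ n, ∀ p ∈ Λn n, ∀ t : ℝ, 0 < t → (p.1, t • p.2) ∈ Λn n) ∧
      (∀ n, IsClosedIn (U ×ˢ ({0}ᶜ : Set (EuclideanSpace ℝ (Fin d)))) (Λn n)) ∧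
      (∀ n, IsCompact (Prod.fst '' Λn n) ∧ Prod.fst '' Λn n ⊆ U) ∧
      (∀ n, Λn n ⊆ Λn (n + 1)) ∧
      (∀ n, Λn n ⊆ interiorIn Γ (Λn (n + 1))) ∧
      (⋃ n, Λn n) = Γ ∩ lam ∧
      (∀ Γ' : Set (EuclideanSpace ℝ (Fin d) × EuclideanSpace ℝ (Fin d)),
        Γ' ⊆ Γ ∩ lam →
        (∀ p ∈ Γ', ∀ t : ℝ, 0 < t → (p.1, t • p.2) ∈ Γ') →
        IsClosedIn (U ×ˢ ({0}ᶜ : Set (EuclideanSpace ℝ (Fin d)))) Γ' →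
        IsCompact (Prod.fst '' Γ') → Prod.fst '' Γ' ⊆ U →
        ∃ n, Γ' ⊆ Λn n) := by
  classical
  obtain ⟨F, hF, rfl⟩ := hΓcl
  obtain ⟨W, hW, hlam⟩ := hlamop
  have hB : IsOpen (U ×ˢ ({0}ᶜ : Set (EuclideanSpace ℝ (Fin d)))) :=
    hU.prod isOpen_compl_singleton
  have hlo : IsOpen lam := by rw [hlam]; exact hW.inter hB
  have hlB : lam ⊆ U ×ˢ ({0}ᶜ : Set (EuclideanSpace ℝ (Fin d))) := by
    rw [hlam]; exact inter_subset_right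
  set B := U ×ˢ ({0}ᶜ : Set (EuclideanSpace ℝ (Fin d))) with hBdef
  have hne : (lamᶜ).Nonempty := ⟨(0, 0), fun h => (hlB h).2 rfl⟩
  let N : EuclideanSpace ℝ (Fin d) × EuclideanSpace ℝ (Fin d) →
      EuclideanSpace ℝ (Fin d) × EuclideanSpace ℝ (Fin d) := fun p => (p.1, ‖p.2‖⁻¹ • p.2)
  have hNt : ∀ p : EuclideanSpace ℝ (Fin d) × EuclideanSpace ℝ (Fin d), ∀ t : ℝ, 0 < t →
      N (p.1, t • p.2) = N p := by
    intro p t ht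
    simp only [N, norm_smul, Real.norm_eq_abs, abs_of_pos ht, smul_smul, Prod.mk.injEq, true_and]
    congr 1
    rw [mul_inv, mul_right_comm, inv_mul_cancel₀ ht.ne', one_mul]
  have hNc : ContinuousOn N B := by
    have h1 : ContinuousOn (fun p : EuclideanSpace ℝ (Fin d) × EuclideanSpace ℝ (Fin d) =>
        ‖p.2‖⁻¹) B :=
      ContinuousOn.inv₀ continuousOn_snd.norm (fun p hp => norm_ne_zero_iff.2 hp.2)
    have h2 : ContinuousOn (fun p : EuclideanSpace ℝ (Fin d) × EuclideanSpace ℝ (Fin d) =>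
        ‖p.2‖⁻¹ • p.2) B := h1.smul continuousOn_snd
    exact continuousOn_fst.prodMk h2
  have hpos : ∀ p ∈ B, 0 < ‖p.2‖ := fun p hp => norm_pos_iff.2 hp.2
  have hNS : ∀ p ∈ B, ‖(N p).2‖ = 1 := by
    intro p hp
    simp [N, norm_smul, inv_mul_cancel₀ (hpos p hp).ne']
  have hNinv : ∀ p ∈ B, (p.1, ‖p.2‖ • (N p).2) = p := by
    intro p hp
    simp [N, smul_smul, mul_inv_cancel₀ (hpos p hp).ne']
  have hN1 : ∀ p : EuclideanSpace ℝ (Fin d) × EuclideanSpace ℝ (Fin d), ‖p.2‖ = 1 → N p = p := by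
    intro p hp
    simp [N, hp]
  let C : ℕ → Set (EuclideanSpace ℝ (Fin d) × EuclideanSpace ℝ (Fin d)) :=
    fun n => {q | 1 / ((n : ℝ) + 1) ≤ infDist q lamᶜ ∧ ‖q.1‖ ≤ n}
  let O : ℕ → Set (EuclideanSpace ℝ (Fin d) × EuclideanSpace ℝ (Fin d)) :=
    fun n => {q | 1 / ((n : ℝ) + 1) < infDist q lamᶜ ∧ ‖q.1‖ < n}
  have hC : ∀ n, IsClosed (C n) := fun n =>
    (isClosed_le continuous_const (continuous_infDist_pt _)).inter
      (isClosed_le continuous_fst.norm continuous_const)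
  have hO : ∀ n, IsOpen (O n) := fun n =>
    (isOpen_lt continuous_const (continuous_infDist_pt _)).inter
      (isOpen_lt continuous_fst.norm continuous_const)
  have hOC : ∀ n, O n ⊆ C n := fun n q hq => ⟨hq.1.le, hq.2.le⟩
  have hCO : ∀ n, C n ⊆ O (n + 1) := by
    intro n q hq
    refine ⟨lt_of_lt_of_le ?_ hq.1, lt_of_le_of_lt hq.2 ?_⟩
    · apply one_div_lt_one_div_of_lt <;> push_cast <;> [positivity; linarith]
    · push_cast; linarith
  have hCl : ∀ n, C n ⊆ lam := by
    intro n q hq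
    by_contra h
    have h0 : infDist q lamᶜ = 0 := infDist_zero_of_mem h
    have h1 := hq.1
    rw [h0] at h1
    have : (0 : ℝ) < 1 / ((n : ℝ) + 1) := by positivity
    linarith
  have hcov : ∀ q ∈ lam, ∃ n, q ∈ O n := by
    intro q hq
    have h0 : 0 < infDist q lamᶜ :=
      (hlo.isClosed_compl.notMem_iff_infDist_pos hne).1 (fun h => h hq)
    obtain ⟨n, hn⟩ := exists_nat_one_div_lt h0
    obtain ⟨m, hm⟩ := exists_nat_gt ‖q.1‖
    refine ⟨max n m, lt_of_le_of_lt ?_ hn, lt_of_lt_of_le hm ?_⟩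
    · apply one_div_le_one_div_of_le
      · positivity
      · have : (n : ℝ) ≤ ((max n m : ℕ) : ℝ) := by exact_mod_cast le_max_left n m
        linarith
    · exact_mod_cast le_max_right n m
  have hOmono : Monotone O := monotone_nat_of_le_succ (fun n => (hOC n).trans (hCO n))
  refine ⟨fun n => {p | p ∈ F ∩ B ∧ N p ∈ C n}, ?_, ?_, ?_, ?_, ?_, ?_, ?_⟩
  · rintro n p ⟨hp, hp2⟩ t ht
    refine ⟨hΓcone p hp t ht, ?_⟩
    rw [hNt p t ht]; exact hp2
  · intro n
    obtain ⟨u, hu, hu2⟩ := continuousOn_iff_isClosed.1 hNc (C n) (hC n)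
    refine ⟨F ∩ u, hF.inter hu, ?_⟩
    ext p
    have := Set.ext_iff.1 hu2 p
    simp only [mem_inter_iff, mem_preimage, mem_setOf_eq] at this ⊢
    tauto
  · intro n
    refine ⟨?_, ?_⟩
    · have hK : IsCompact ((F ∩ C n) ∩
          (closedBall (0 : EuclideanSpace ℝ (Fin d)) n ×ˢ
            sphere (0 : EuclideanSpace ℝ (Fin d)) 1)) :=
        ((isCompact_closedBall _ _).prod (isCompact_sphere _ _)).inter_left (hF.inter (hC n))
      convert hK.image continuous_fst using 1
      ext x
      constructor
      · rintro ⟨p, ⟨hp, hp2⟩, rfl⟩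
        refine ⟨N p, ⟨⟨?_, hp2⟩, ?_, ?_⟩, rfl⟩
        · exact (hΓcone p hp _ (inv_pos.2 (hpos p hp.2))).1
        · simpa using hp2.2
        · simpa using hNS p hp.2
      · rintro ⟨p, ⟨⟨hp, hp2⟩, -, hp3⟩, rfl⟩
        refine ⟨p, ⟨⟨hp, hlB (hCl n hp2)⟩, ?_⟩, rfl⟩
        rw [hN1 p (by simpa using hp3)]
        exact hp2
    · rintro _ ⟨p, ⟨hp, -⟩, rfl⟩
      exact hp.2.1
  · rintro n p ⟨hp, hp2⟩
    exact ⟨hp, hOC _ (hCO n hp2)⟩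
  · rintro n p ⟨hp, hp2⟩
    refine ⟨hp, fun hcl => ?_⟩
    have ho : IsOpen (B ∩ N ⁻¹' O (n + 1)) := hNc.isOpen_inter_preimage hB (hO _)
    obtain ⟨q, hq, hq2, hq3⟩ := mem_closure_iff.1 hcl _ ho ⟨hp.2, hCO n hp2⟩
    exact hq3 ⟨hq2, hOC _ hq.2⟩
  · ext p
    simp only [mem_iUnion, mem_setOf_eq]
    constructor
    · rintro ⟨n, hp, hp2⟩
      refine ⟨hp, ?_⟩
      have := hlamcone _ (hCl n hp2) _ (hpos p hp.2)
      have h2 := hNinv p hp.2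
      rw [← h2]; exact this
    · rintro ⟨hp, hp2⟩
      obtain ⟨n, hn⟩ := hcov (N p) (hlamcone p hp2 _ (inv_pos.2 (hpos p hp.2)))
      exact ⟨n, hp, hOC n hn⟩
  · rintro Γ' hsub hcone ⟨F', hF', hΓ'⟩ hcomp hpU
    have hK : IsCompact (F' ∩ ((Prod.fst '' Γ') ×ˢ
        sphere (0 : EuclideanSpace ℝ (Fin d)) 1)) :=
      (hcomp.prod (isCompact_sphere _ _)).inter_left hF'
    have hKl : F' ∩ ((Prod.fst '' Γ') ×ˢ
        sphere (0 : EuclideanSpace ℝ (Fin d)) 1) ⊆ ⋃ n, O n := by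
      rintro q ⟨hq, hq1, hq2⟩
      have : q ∈ Γ' := by
        rw [hΓ']
        refine ⟨hq, hpU hq1, ?_⟩
        intro h0
        have h0' : q.2 = 0 := h0
        rw [h0'] at hq2
        simp at hq2
      exact mem_iUnion.2 (hcov q (hsub this).2)
    obtain ⟨n, hn⟩ := hK.elim_directed_cover O hO hKl hOmono.directed_le
    refine ⟨n, fun p hp => ⟨(hsub hp).1, hOC n (hn ⟨?_, ⟨p, hp, rfl⟩, ?_⟩)⟩⟩
    · have := hcone p hp _ (inv_pos.2 (hpos p (hsub hp).1.2))
      rw [hΓ'] at this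
      exact this.1
    · simpa using hNS p (hsub hp).1.2
end

section
/- Let F be a set and A : ℕ → ℕ → (ℕ → ℕ) → 𝒫(F) a family of subsets of F such that A n m α ⊆ A n m' α' whenever m ≤ m' and α(k) ≤ α'(k) for all k ∈ ℕ. Then there exists a family B : (ℕ → ℕ) → 𝒫(F) such that: (i) B α ⊆ B α' whenever α(k) ≤ α'(k) for all k; (ii) for every α there exist functions m : ℕ → ℕ and γ : ℕ → (ℕ → ℕ) with B α = ⋂_{n∈ℕ} A n (m n) (γ n); and (iii) ⋃_{α : ℕ→ℕ} B α = ⋃_{β : ℕ→ℕ} ⋂_{n∈ℕ} ⋃_{γ : ℕ→ℕ} A n (β n) γ. -/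
/-- combinatorial core of the quasi-(LB) inductive limit lemma: a monotone
`ℕ^ℕ`-indexed family of countable intersections covering the mixed projective–inductive
limit. -/
theorem stmt19 {F : Type*} (A : ℕ → ℕ → (ℕ → ℕ) → Set F)
    (hA : ∀ (n m m' : ℕ) (α α' : ℕ → ℕ), m ≤ m' → (∀ k, α k ≤ α' k) →
      A n m α ⊆ A n m' α') :
    ∃ B : (ℕ → ℕ) → Set F,
      (∀ α α' : ℕ → ℕ, (∀ k, α k ≤ α' k) → B α ⊆ B α') ∧
      (∀ α : ℕ → ℕ, ∃ (m : ℕ → ℕ) (γ : ℕ → (ℕ → ℕ)), B α = ⋂ n, A n (m n) (γ n)) ∧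
      (⋃ α : ℕ → ℕ, B α) = ⋃ β : ℕ → ℕ, ⋂ n, ⋃ γ : ℕ → ℕ, A n (β n) γ := by
  refine ⟨fun α => ⋂ n, A n (α (Nat.pair n 0)) (fun k => α (Nat.pair n (k + 1))), ?_, ?_, ?_⟩
  · intro α α' h
    exact Set.iInter_mono fun n => hA n _ _ _ _ (h _) (fun k => h _)
  · intro α
    exact ⟨fun n => α (Nat.pair n 0), fun n k => α (Nat.pair n (k + 1)), rfl⟩
  · ext x
    simp only [Set.mem_iUnion, Set.mem_iInter]
    constructor
    · rintro ⟨α, h⟩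
      exact ⟨fun n => α (Nat.pair n 0), fun n => ⟨_, h n⟩⟩
    · rintro ⟨β, h⟩
      choose γ hγ using h
      refine ⟨fun p => Nat.casesOn (Nat.unpair p).2 (β (Nat.unpair p).1)
        (fun k => γ (Nat.unpair p).1 k), fun n => ?_⟩
      simp only [Nat.unpair_pair]
      exact hγ n
end
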